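/- arXiv:2208.02033 — 3 statements merged into one kernel-verified Lean document; each statement's English description precedes it below -/
import Mathlib

section
/- Let L : ℝⁿ × ℝⁿ × ℝ → ℝ be a smooth action-dependent Lagrangian. Suppose q : ℝ → ℝⁿ is twice continuously differentiable and z : ℝ → ℝ is continuously differentiable with z'(t) = L(q(t), q'(t), z(t)), and the pair satisfies the Herglotz equations: for each i, d/dt[∂L/∂q̇ⁱ(q(t), q'(t), z(t))] = ∂L/∂qⁱ(q(t), q'(t), z(t)) + ∂L/∂q̇ⁱ(q(t), q'(t), z(t)) · ∂L/∂z(q(t), q'(t), z(t)). Then the energy E_L(t) := Σᵢ q'ⁱ(t) · ∂L/∂q̇ⁱ(q(t), q'(t), z(t)) − L(q(t), q'(t), z(t)) satisfies d/dt E_L(t) = ∂L/∂z(q(t), q'(t), z(t)) · E_L(t) for all t. -/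
open scoped BigOperators

/-- Partial derivative of `L(q, q̇, z)` with respect to `qⁱ`. -/
noncomputable def pQ {n : ℕ} (L : (Fin n → ℝ) → (Fin n → ℝ) → ℝ → ℝ) (i : Fin n)
    (a b : Fin n → ℝ) (c : ℝ) : ℝ :=
  fderiv ℝ (fun x => L x b c) a (Pi.single i 1)

/-- Partial derivative of `L(q, q̇, z)` with respect to `q̇ⁱ`. -/
noncomputable def pV {n : ℕ} (L : (Fin n → ℝ) → (Fin n → ℝ) → ℝ → ℝ) (i : Fin n)
    (a b : Fin n → ℝ) (c : ℝ) : ℝ :=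
  fderiv ℝ (fun v => L a v c) b (Pi.single i 1)

/-- Partial derivative of `L(q, q̇, z)` with respect to `z`. -/
noncomputable def pZ {n : ℕ} (L : (Fin n → ℝ) → (Fin n → ℝ) → ℝ → ℝ)
    (a b : Fin n → ℝ) (c : ℝ) : ℝ :=
  deriv (fun s => L a b s) c

section PartialDerivatives

variable {n : ℕ} {L : (Fin n → ℝ) → (Fin n → ℝ) → ℝ → ℝ}

theorem pQ_eq_fderiv
    (hL : Differentiable ℝ (fun p : (Fin n → ℝ) × (Fin n → ℝ) × ℝ => L p.1 p.2.1 p.2.2))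
    (i : Fin n) (a b : Fin n → ℝ) (c : ℝ) :
    pQ L i a b c = fderiv ℝ (fun p : (Fin n → ℝ) × (Fin n → ℝ) × ℝ => L p.1 p.2.1 p.2.2)
      (a, b, c) (Pi.single i 1, 0, 0) := by
  have h := (hL (a, b, c)).hasFDerivAt.comp a
    ((hasFDerivAt_id (𝕜 := ℝ) a).prodMk (hasFDerivAt_const (b, c) a))
  exact congrArg (fun f => f (Pi.single i 1)) h.fderiv

theorem pV_eq_fderiv
    (hL : Differentiable ℝ (fun p : (Fin n → ℝ) × (Fin n → ℝ) × ℝ => L p.1 p.2.1 p.2.2))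
    (i : Fin n) (a b : Fin n → ℝ) (c : ℝ) :
    pV L i a b c = fderiv ℝ (fun p : (Fin n → ℝ) × (Fin n → ℝ) × ℝ => L p.1 p.2.1 p.2.2)
      (a, b, c) (0, Pi.single i 1, 0) := by
  have h := (hL (a, b, c)).hasFDerivAt.comp b
    ((hasFDerivAt_const a b).prodMk
      ((hasFDerivAt_id (𝕜 := ℝ) b).prodMk (hasFDerivAt_const c b)))
  exact congrArg (fun f => f (Pi.single i 1)) h.fderiv

theorem pZ_eq_fderiv
    (hL : Differentiable ℝ (fun p : (Fin n → ℝ) × (Fin n → ℝ) × ℝ => L p.1 p.2.1 p.2.2))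
    (a b : Fin n → ℝ) (c : ℝ) :
    pZ L a b c = fderiv ℝ (fun p : (Fin n → ℝ) × (Fin n → ℝ) × ℝ => L p.1 p.2.1 p.2.2)
      (a, b, c) (0, 0, 1) := by
  have h := (hasDerivAt_const c a).prodMk ((hasDerivAt_const c b).prodMk (hasDerivAt_id c))
  exact ((hL (a, b, c)).hasFDerivAt.comp_hasDerivAt c h).deriv

/-- The total derivative of `L` in terms of its partial derivatives. -/
theorem fderiv_eq_sum_partials
    (hL : Differentiable ℝ (fun p : (Fin n → ℝ) × (Fin n → ℝ) × ℝ => L p.1 p.2.1 p.2.2))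
    (a b u v : Fin n → ℝ) (c w : ℝ) :
    fderiv ℝ (fun p : (Fin n → ℝ) × (Fin n → ℝ) × ℝ => L p.1 p.2.1 p.2.2) (a, b, c) (u, v, w)
      = ∑ i, u i * pQ L i a b c + ∑ i, v i * pV L i a b c + w * pZ L a b c := by
  simp only [pQ_eq_fderiv hL, pV_eq_fderiv hL, pZ_eq_fderiv hL, ← smul_eq_mul, ← map_smul,
    ← map_sum, ← map_add]
  congr 1
  ext j <;> simp [Prod.fst_sum, Prod.snd_sum, Finset.sum_apply, Pi.single_apply]

end PartialDerivatives

/-- Along solutions of the Herglotz equations, the energy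
`E_L = Σᵢ q̇ⁱ ∂L/∂q̇ⁱ − L` satisfies `dE_L/dt = (∂L/∂z) · E_L`. -/
theorem energy_dissipation_along_herglotz {n : ℕ}
    (L : (Fin n → ℝ) → (Fin n → ℝ) → ℝ → ℝ)
    (hL : ContDiff ℝ (⊤ : ℕ∞) (fun p : (Fin n → ℝ) × (Fin n → ℝ) × ℝ => L p.1 p.2.1 p.2.2))
    (q : ℝ → (Fin n → ℝ)) (z : ℝ → ℝ)
    (hq : ContDiff ℝ 2 q) (hz : ContDiff ℝ 1 z)
    (hzeq : ∀ t, deriv z t = L (q t) (deriv q t) (z t))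
    (hHerglotz : ∀ (i : Fin n) (t : ℝ),
      deriv (fun s => pV L i (q s) (deriv q s) (z s)) t
        = pQ L i (q t) (deriv q t) (z t)
          + pV L i (q t) (deriv q t) (z t) * pZ L (q t) (deriv q t) (z t)) :
    ∀ t : ℝ,
      deriv (fun s =>
        (∑ i, deriv q s i * pV L i (q s) (deriv q s) (z s)) - L (q s) (deriv q s) (z s)) t
      = pZ L (q t) (deriv q t) (z t)
        * ((∑ i, deriv q t i * pV L i (q t) (deriv q t) (z t))
            - L (q t) (deriv q t) (z t)) := by
  intro t
  have hLd := hL.differentiable (by simp)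
  have hq' : ContDiff ℝ 1 (deriv q) := hq.deriv'
  have hqt : HasDerivAt q (deriv q t) t := (hq.differentiable (by simp) t).hasDerivAt
  have hvt : HasDerivAt (deriv q) (deriv (deriv q) t) t :=
    (hq'.differentiable (by simp) t).hasDerivAt
  have hzt : HasDerivAt z (deriv z t) t := (hz.differentiable (by simp) t).hasDerivAt
  have hcurve := hqt.prodMk (hvt.prodMk hzt)
  have hLt : HasDerivAt (fun s => L (q s) (deriv q s) (z s))
      (∑ i, deriv q t i * pQ L i (q t) (deriv q t) (z t)
        + ∑ i, deriv (deriv q) t i * pV L i (q t) (deriv q t) (z t)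
        + deriv z t * pZ L (q t) (deriv q t) (z t)) t := by
    rw [← fderiv_eq_sum_partials hLd]
    exact (hLd (q t, deriv q t, z t)).hasFDerivAt.comp_hasDerivAt t hcurve
  have hpV (i : Fin n) : HasDerivAt (fun s => pV L i (q s) (deriv q s) (z s))
      (pQ L i (q t) (deriv q t) (z t)
        + pV L i (q t) (deriv q t) (z t) * pZ L (q t) (deriv q t) (z t)) t := by
    rw [← hHerglotz i t]
    apply DifferentiableAt.hasDerivAt
    simp only [pV_eq_fderiv hLd]
    have hD := (hL.fderiv_right (m := (⊤ : ℕ∞)) (by simp)).differentiable (by simp)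
    exact ((hD (q t, deriv q t, z t)).comp t hcurve.differentiableAt).clm_apply
      (differentiableAt_const _)
  have hE := (HasDerivAt.fun_sum fun i (_ : i ∈ Finset.univ) =>
    (hasDerivAt_pi.1 hvt i).mul (hpV i)).sub hLt
  refine hE.deriv.trans ?_
  rw [hzeq t]
  simp only [Finset.sum_add_distrib, mul_add, mul_sub, Finset.mul_sum]
  have hcomm : ∑ i, deriv q t i * (pV L i (q t) (deriv q t) (z t) * pZ L (q t) (deriv q t) (z t))
      = ∑ i, pZ L (q t) (deriv q t) (z t) * (deriv q t i * pV L i (q t) (deriv q t) (z t)) :=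
    Finset.sum_congr rfl fun i _ => by ring
  rw [hcomm]
  ring
end

section
/- Let L : ℝⁿ × ℝⁿ × ℝ → ℝ be smooth with arguments (q, q̇, z), and suppose that at a point (q, q̇, z) the Hessian matrix W with entries W_{ij} = ∂²L/∂q̇ⁱ∂q̇ʲ is invertible, with inverse entries W^{ij}. Define E_L = Σᵢ q̇ⁱ ∂L/∂q̇ⁱ − L. Then at that point, ∂E_L/∂z − Σ_{i,j} W^{ij} (∂²L/∂q̇ⁱ∂z)(∂E_L/∂q̇ʲ) = −∂L/∂z. -/
open scoped BigOperators

/-- The energy `E_L = Σᵢ q̇ⁱ ∂L/∂q̇ⁱ − L` of an action-dependent Lagrangian. -/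
noncomputable def energy {n : ℕ} (L : (Fin n → ℝ) → (Fin n → ℝ) → ℝ → ℝ)
    (a b : Fin n → ℝ) (c : ℝ) : ℝ :=
  (∑ i, b i * pV L i a b c) - L a b c

section

variable {n : ℕ} {L : (Fin n → ℝ) → (Fin n → ℝ) → ℝ → ℝ}

/-- The velocity partial derivatives of a smooth Lagrangian are smooth. -/
theorem contDiff_pV
    (hL : ContDiff ℝ (⊤ : ℕ∞) (fun m : (Fin n → ℝ) × (Fin n → ℝ) × ℝ => L m.1 m.2.1 m.2.2))
    (i : Fin n) :
    ContDiff ℝ (⊤ : ℕ∞)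
      (fun m : (Fin n → ℝ) × (Fin n → ℝ) × ℝ => pV L i m.1 m.2.1 m.2.2) := by
  have h : ContDiff ℝ (⊤ : ℕ∞)
      (fun m : (Fin n → ℝ) × (Fin n → ℝ) × ℝ => fderiv ℝ (fun v => L m.1 v m.2.2) m.2.1) := by
    refine ContDiff.fderiv (n := (⊤ : ℕ∞)) (m := (⊤ : ℕ∞))
      (f := fun (m : (Fin n → ℝ) × (Fin n → ℝ) × ℝ) v => L m.1 v m.2.2) ?_ (by fun_prop) (by simp)
    exact hL.comp (g := fun m : (Fin n → ℝ) × (Fin n → ℝ) × ℝ => L m.1 m.2.1 m.2.2)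
      (f := fun p : ((Fin n → ℝ) × (Fin n → ℝ) × ℝ) × (Fin n → ℝ) => (p.1.1, p.2, p.1.2.2))
      (by fun_prop)
  exact h.clm_apply contDiff_const

/-- The velocity Hessian of a smooth Lagrangian is symmetric. -/
theorem fderiv_pV_comm
    (hL : ContDiff ℝ (⊤ : ℕ∞) (fun m : (Fin n → ℝ) × (Fin n → ℝ) × ℝ => L m.1 m.2.1 m.2.2))
    (a b : Fin n → ℝ) (c : ℝ) (i j : Fin n) :
    fderiv ℝ (fun v => pV L i a v c) b (Pi.single j 1)
      = fderiv ℝ (fun v => pV L j a v c) b (Pi.single i 1) := by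
  have hf : ContDiff ℝ (⊤ : ℕ∞) (fun v => L a v c) :=
    hL.comp (f := fun v : Fin n → ℝ => (a, v, c)) (by fun_prop)
  have hd : DifferentiableAt ℝ (fderiv ℝ (fun v => L a v c)) b :=
    (hf.fderiv_right (m := 1) (by simpa [one_add_one_eq_two] using ENat.LEInfty.out)).differentiable one_ne_zero b
  have key (k l : Fin n) : fderiv ℝ (fun v => pV L k a v c) b (Pi.single l 1)
      = fderiv ℝ (fderiv ℝ (fun v => L a v c)) b (Pi.single l 1) (Pi.single k 1) := by
    simp only [pV]
    rw [fderiv_clm_apply hd (differentiableAt_const _)]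
    simp
  rw [key, key]
  exact (hf.contDiffAt.isSymmSndFDerivAt (by simpa using ENat.LEInfty.out)) _ _

/-- The `z`-derivative of the energy. -/
theorem deriv_energy
    (hL : ContDiff ℝ (⊤ : ℕ∞) (fun m : (Fin n → ℝ) × (Fin n → ℝ) × ℝ => L m.1 m.2.1 m.2.2))
    (a b : Fin n → ℝ) (c : ℝ) :
    deriv (fun s => energy L a b s) c
      = ∑ i, b i * deriv (fun s => pV L i a b s) c - pZ L a b c := by
  have hf : DifferentiableAt ℝ (fun s => L a b s) c :=
    (hL.comp (f := fun s : ℝ => (a, b, s)) (by fun_prop)).differentiable (by simp) c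
  have hp (i : Fin n) : DifferentiableAt ℝ (fun s => pV L i a b s) c :=
    ((contDiff_pV hL i).comp (f := fun s : ℝ => (a, b, s)) (by fun_prop)).differentiable
      (by simp) c
  exact ((HasDerivAt.fun_sum fun i _ => (hp i).hasDerivAt.const_mul (b i)).sub
    hf.hasDerivAt).deriv

/-- The velocity derivatives of the energy. -/
theorem fderiv_energy
    (hL : ContDiff ℝ (⊤ : ℕ∞) (fun m : (Fin n → ℝ) × (Fin n → ℝ) × ℝ => L m.1 m.2.1 m.2.2))
    (a b : Fin n → ℝ) (c : ℝ) (j : Fin n) :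
    fderiv ℝ (fun v => energy L a v c) b (Pi.single j 1)
      = ∑ i, b i * fderiv ℝ (fun v => pV L i a v c) b (Pi.single j 1) := by
  have hf : DifferentiableAt ℝ (fun v => L a v c) b :=
    (hL.comp (f := fun v : Fin n → ℝ => (a, v, c)) (by fun_prop)).differentiable (by simp) b
  have hp (i : Fin n) : DifferentiableAt ℝ (fun v => pV L i a v c) b :=
    ((contDiff_pV hL i).comp (f := fun v : Fin n → ℝ => (a, v, c)) (by fun_prop)).differentiable
      (by simp) b
  have h : HasFDerivAt (fun v => energy L a v c) _ b :=
    (HasFDerivAt.fun_sum (u := Finset.univ) fun i _ =>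
      (hasFDerivAt_apply i b).mul (hp i).hasFDerivAt).sub hf.hasFDerivAt
  rw [h.fderiv]
  simp [Finset.sum_add_distrib, Pi.single_apply, pV]

end

/-- The Reeb vector field identity `R_L(E_L) = −∂L/∂z` in coordinates: at a point where the
velocity Hessian `W` is invertible with inverse `Winv`,
`∂E_L/∂z − Σ_{i,j} W^{ij} (∂²L/∂q̇ⁱ∂z)(∂E_L/∂q̇ʲ) = −∂L/∂z`. -/
theorem reeb_of_energy_eq_neg_pZ {n : ℕ}
    (L : (Fin n → ℝ) → (Fin n → ℝ) → ℝ → ℝ)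
    (hL : ContDiff ℝ (⊤ : ℕ∞) (fun m : (Fin n → ℝ) × (Fin n → ℝ) × ℝ => L m.1 m.2.1 m.2.2))
    (a b : Fin n → ℝ) (c : ℝ)
    (W Winv : Matrix (Fin n) (Fin n) ℝ)
    (hWdef : ∀ i j, W i j = fderiv ℝ (fun v => pV L i a v c) b (Pi.single j 1))
    (hWinv₁ : W * Winv = 1) (hWinv₂ : Winv * W = 1) :
    deriv (fun s => energy L a b s) c
      - ∑ i, ∑ j, Winv i j * deriv (fun s => pV L i a b s) c
          * fderiv ℝ (fun v => energy L a v c) b (Pi.single j 1)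
      = -(pZ L a b c) := by
  have hinv (i k : Fin n) : ∑ j, Winv i j * W k j = if i = k then 1 else 0 := by
    rw [← Matrix.one_apply, ← hWinv₂, Matrix.mul_apply]
    refine Finset.sum_congr rfl fun j _ => ?_
    rw [hWdef k j, hWdef j k, fderiv_pV_comm hL]
  have hsum (i : Fin n) :
      ∑ j, Winv i j * deriv (fun s => pV L i a b s) c * ∑ k, b k * W k j
        = b i * deriv (fun s => pV L i a b s) c := by
    calc _ = deriv (fun s => pV L i a b s) c * ∑ k, b k * ∑ j, Winv i j * W k j := by
          simp only [Finset.mul_sum]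
          rw [Finset.sum_comm]
          refine Finset.sum_congr rfl fun k _ => Finset.sum_congr rfl fun j _ => ?_
          ring
      _ = _ := by
          simp only [hinv, mul_ite, mul_one, mul_zero, Finset.sum_ite_eq, Finset.mem_univ, if_true]
          exact mul_comm _ _
  simp only [deriv_energy hL, fderiv_energy hL, ← hWdef, hsum]
  ring
end

section
/- Let (x, y) ∈ ℝ² with x² + y² ≠ 0 and let (ẋ⁻, ẏ⁻) ∈ ℝ². Define ẋ⁺ = (−ẋ⁻x² + ẋ⁻y² − 2ẏ⁻xy)/(x² + y²) and ẏ⁺ = (−2ẋ⁻xy + ẏ⁻x² − ẏ⁻y²)/(x² + y²). Then: (i) for every (v_x, v_y) ∈ ℝ² with x v_x + y v_y = 0, one has ẋ⁻ v_x + ẏ⁻ v_y = ẋ⁺ v_x + ẏ⁺ v_y; and (ii) (ẋ⁺)² + (ẏ⁺)² = (ẋ⁻)² + (ẏ⁻)². -/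
/-- The circular-billiard impact map preserves tangential momentum and kinetic energy. -/
theorem billiard_impact_map_properties (x y vxm vym : ℝ) (h : x ^ 2 + y ^ 2 ≠ 0) :
    (∀ wx wy : ℝ, x * wx + y * wy = 0 →
      vxm * wx + vym * wy
        = ((-vxm * x ^ 2 + vxm * y ^ 2 - 2 * vym * x * y) / (x ^ 2 + y ^ 2)) * wx
          + ((-2 * vxm * x * y + vym * x ^ 2 - vym * y ^ 2) / (x ^ 2 + y ^ 2)) * wy)
    ∧ ((-vxm * x ^ 2 + vxm * y ^ 2 - 2 * vym * x * y) / (x ^ 2 + y ^ 2)) ^ 2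
        + ((-2 * vxm * x * y + vym * x ^ 2 - vym * y ^ 2) / (x ^ 2 + y ^ 2)) ^ 2
      = vxm ^ 2 + vym ^ 2 := by
  constructor
  · intro wx wy hw
    field_simp
    linear_combination 2 * (x * vxm + y * vym) * hw
  · field_simp
    ring
end
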